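/- (i) A weak coaction ρ of H^0 on a unital C*-algebra A is inner if and only if ρ is strongly Morita equivalent to the trivial coaction ρ^A_{H^0} (defined by ρ^A_{H^0}(a) = a⊗1^0). (ii) A coaction ρ of H^0 on A is strongly inner if and only if ρ is strongly Morita equivalent to the trivial coaction ρ^A_{H^0}. -/

import Mathlib

open scoped TensorProduct
open Filter Topology
set_option maxHeartbeats 1000000
set_option linter.unusedSectionVars false
set_option synthInstance.maxHeartbeats 400000
noncomputable section
namespace SMEPaper
universe u

/-! ### Generalities on tensor products with a finite dimensional C*-algebra -/

/-- Contraction of the right tensor factor against a linear functional: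
`appRight f (m ⊗ c) = f c • m`. -/
def appRight {M C : Type*} [AddCommGroup M] [Module ℂ M] [AddCommGroup C] [Module ℂ C]
    (f : C →ₗ[ℂ] ℂ) : M ⊗[ℂ] C →ₗ[ℂ] M :=
  (TensorProduct.rid ℂ M).toLinearMap ∘ₗ TensorProduct.map LinearMap.id f

/-- The `i`-th coordinate, with respect to the canonical finite basis of `C`, of an
element of `M ⊗[ℂ] C`. -/
def tcoord {M C : Type*} [AddCommGroup M] [Module ℂ M] [AddCommGroup C] [Module ℂ C]
    [FiniteDimensional ℂ C] (i : Fin (Module.finrank ℂ C)) : M ⊗[ℂ] C →ₗ[ℂ] M :=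
  appRight ((Module.finBasis ℂ C).coord i)

/-- The star operation on `M ⊗[ℂ] C` (`C` finite dimensional) where the star operation on the
first factor is supplied as a function: on simple tensors, `m ⊗ c ↦ sM m ⊗ star c`. -/
def tstarWith {M C : Type*} [AddCommGroup M] [Module ℂ M] [Ring C] [Algebra ℂ C]
    [StarRing C] [FiniteDimensional ℂ C] (sM : M → M) (t : M ⊗[ℂ] C) : M ⊗[ℂ] C :=
  ∑ i, sM (tcoord i t) ⊗ₜ star (Module.finBasis ℂ C i)

/-- Combination of an operation on the first factors and an operation on the second (finite
dimensional) factors to an operation on tensor products: on simple tensors,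
`tmix op cop (p ⊗ c) (q ⊗ d) = op p q ⊗ cop c d`. -/
def tmix {P Q R C : Type*} [AddCommGroup P] [Module ℂ P] [AddCommGroup Q] [Module ℂ Q]
    [AddCommGroup R] [Module ℂ R] [Ring C] [Algebra ℂ C] [FiniteDimensional ℂ C]
    (op : P → Q → R) (cop : C → C → C) (s : P ⊗[ℂ] C) (t : Q ⊗[ℂ] C) : R ⊗[ℂ] C :=
  ∑ i, ∑ j,
    op (tcoord i s) (tcoord j t) ⊗ₜ cop (Module.finBasis ℂ C i) (Module.finBasis ℂ C j)

/-- The operation on tensor products induced by an operation on the first factors (and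
multiplication in the second): `tact op (p ⊗ c) (q ⊗ d) = op p q ⊗ (c * d)`. -/
def tact {P Q R C : Type*} [AddCommGroup P] [Module ℂ P] [AddCommGroup Q] [Module ℂ Q]
    [AddCommGroup R] [Module ℂ R] [Ring C] [Algebra ℂ C] [FiniteDimensional ℂ C]
    (op : P → Q → R) : P ⊗[ℂ] C → Q ⊗[ℂ] C → R ⊗[ℂ] C :=
  tmix op (· * ·)

/-- The left inner product on `X ⊗ C` induced by a left (`A`-valued) inner product on `X`:
`(x ⊗ c), (y ⊗ d) ↦ inn x y ⊗ (c * star d)`. -/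
def tinnL {X A C : Type*} [AddCommGroup X] [Module ℂ X] [AddCommGroup A] [Module ℂ A]
    [Ring C] [Algebra ℂ C] [StarRing C] [FiniteDimensional ℂ C]
    (inn : X → X → A) : X ⊗[ℂ] C → X ⊗[ℂ] C → A ⊗[ℂ] C :=
  tmix inn (fun c d => c * star d)

/-- The right inner product on `X ⊗ C` induced by a right (`B`-valued) inner product on `X`:
`(x ⊗ c), (y ⊗ d) ↦ inn x y ⊗ (star c * d)`. -/
def tinnR {X B C : Type*} [AddCommGroup X] [Module ℂ X] [AddCommGroup B] [Module ℂ B]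
    [Ring C] [Algebra ℂ C] [StarRing C] [FiniteDimensional ℂ C]
    (inn : X → X → B) : X ⊗[ℂ] C → X ⊗[ℂ] C → B ⊗[ℂ] C :=
  tmix inn (fun c d => star c * d)

/-! ### Finite dimensional C*-Hopf algebras -/

/-- The data and axioms of a finite dimensional C*-Hopf algebra structure on the finite
dimensional C*-algebra `H0`: a comultiplication, counit and antipode satisfying the Hopf
algebra axioms, compatibly with the ⋆-structure. -/
structure HopfAlgData (H0 : Type u) [Ring H0] [Algebra ℂ H0] [StarRing H0]
    [StarModule ℂ H0] [FiniteDimensional ℂ H0] where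
  comul : H0 →ₐ[ℂ] H0 ⊗[ℂ] H0
  counit : H0 →ₐ[ℂ] ℂ
  antipode : H0 →ₗ[ℂ] H0
  coassoc : ∀ h, TensorProduct.map comul.toLinearMap LinearMap.id (comul h)
      = (TensorProduct.assoc ℂ H0 H0 H0).symm
          (TensorProduct.map LinearMap.id comul.toLinearMap (comul h))
  counit_left : ∀ h,
      (TensorProduct.lid ℂ H0) (TensorProduct.map counit.toLinearMap LinearMap.id (comul h)) = h
  counit_right : ∀ h, appRight counit.toLinearMap (comul h) = h
  antipode_left : ∀ (h : H0) (n : ℕ) (h1 h2 : Fin n → H0),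
      comul h = ∑ i, h1 i ⊗ₜ h2 i → ∑ i, antipode (h1 i) * h2 i = counit h • 1
  antipode_right : ∀ (h : H0) (n : ℕ) (h1 h2 : Fin n → H0),
      comul h = ∑ i, h1 i ⊗ₜ h2 i → ∑ i, h1 i * antipode (h2 i) = counit h • 1
  comul_star : ∀ h, comul (star h) = tstarWith star (comul h)
  counit_star : ∀ h, counit (star h) = starRingEnd ℂ (counit h)

/-! ### Coactions on C*-algebras -/

section Coaction
variable {H0 : Type u} [Ring H0] [Algebra ℂ H0] [StarRing H0] [StarModule ℂ H0]
  [FiniteDimensional ℂ H0]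
variable {A B X : Type u} [Ring A] [Algebra ℂ A] [StarRing A]
  [Ring B] [Algebra ℂ B] [StarRing B] [AddCommGroup X] [Module ℂ X]

/-- `ρ : A → A ⊗ H0` is a weak coaction of `H0` (with counit `ε0`) on `A`:
a unital ⋆-homomorphism with `(id ⊗ ε0) ∘ ρ = id`. -/
structure IsWeakCoaction (ε0 : H0 →ₗ[ℂ] ℂ) (ρ : A →ₗ[ℂ] A ⊗[ℂ] H0) : Prop where
  map_one : ρ 1 = 1
  map_mul : ∀ a b, ρ (a * b) = ρ a * ρ b
  map_star : ∀ a, ρ (star a) = tstarWith star (ρ a)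
  counital : ∀ a, appRight ε0 (ρ a) = a

/-- `ρ : A → A ⊗ H0` is a coaction of `H0` (with comultiplication `Δ0`, counit `ε0`) on `A`:
a weak coaction with `(ρ ⊗ id) ∘ ρ = (id ⊗ Δ0) ∘ ρ`. -/
structure IsCoaction (Δ0 : H0 →ₗ[ℂ] H0 ⊗[ℂ] H0) (ε0 : H0 →ₗ[ℂ] ℂ)
    (ρ : A →ₗ[ℂ] A ⊗[ℂ] H0) extends IsWeakCoaction ε0 ρ : Prop where
  coassoc : ∀ a, TensorProduct.map ρ LinearMap.id (ρ a)
      = (TensorProduct.assoc ℂ A H0 H0).symm (TensorProduct.map LinearMap.id Δ0 (ρ a))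

/-- The pair `(ρ, u)` is a twisted coaction of `H0` on `A`. -/
structure IsTwistedCoaction (Δ0 : H0 →ₗ[ℂ] H0 ⊗[ℂ] H0) (ε0 : H0 →ₗ[ℂ] ℂ)
    (ρ : A →ₗ[ℂ] A ⊗[ℂ] H0) (u : (A ⊗[ℂ] H0) ⊗[ℂ] H0)
    extends IsWeakCoaction ε0 ρ : Prop where
  unitary_left : u * tstarWith (tstarWith star) u = 1
  unitary_right : tstarWith (tstarWith star) u * u = 1
  twisted_coassoc : ∀ a, TensorProduct.map ρ LinearMap.id (ρ a)
      = u * ((TensorProduct.assoc ℂ A H0 H0).symm (TensorProduct.map LinearMap.id Δ0 (ρ a)))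
        * tstarWith (tstarWith star) u
  cocycle : (u ⊗ₜ (1 : H0))
        * TensorProduct.map ((TensorProduct.assoc ℂ A H0 H0).symm.toLinearMap
            ∘ₗ TensorProduct.map LinearMap.id Δ0) LinearMap.id u
      = TensorProduct.map (TensorProduct.map ρ LinearMap.id) LinearMap.id u
        * (TensorProduct.assoc ℂ (A ⊗[ℂ] H0) H0 H0).symm
            (TensorProduct.map LinearMap.id Δ0 u)
  counit_mid : ∀ h : Module.Dual ℂ H0, appRight h (appRight ε0 u) = h 1 • (1 : A)
  counit_out : ∀ h : Module.Dual ℂ H0, appRight ε0 (appRight h u) = h 1 • (1 : A)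

/-- The trivial coaction `a ↦ a ⊗ 1` of `H0` on `A`. -/
def trivialCoaction (H0 : Type u) [Ring H0] [Algebra ℂ H0] (A : Type u) [Ring A]
    [Algebra ℂ A] : A →ₗ[ℂ] A ⊗[ℂ] H0 :=
  (TensorProduct.mk ℂ A H0).flip 1

end Coaction

/-! ### Hilbert bimodules -/

/-- A (pre-)Hilbert `A`–`B` bimodule structure on `X`: a bimodule with a left `A`-valued and a
right `B`-valued inner product, compatible with the module actions, with the appropriate
(conjugate-)linearity, symmetry, positivity and definiteness properties. -/
structure Bimod (A B X : Type u) [Ring A] [Algebra ℂ A] [StarRing A]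
    [Ring B] [Algebra ℂ B] [StarRing B] [AddCommGroup X] [Module ℂ X] where
  ls : A → X → X
  rs : X → B → X
  linn : X → X → A
  rinn : X → X → B
  ls_one : ∀ x, ls 1 x = x
  ls_mul : ∀ a a' x, ls (a * a') x = ls a (ls a' x)
  ls_add : ∀ a a' x, ls (a + a') x = ls a x + ls a' x
  ls_add' : ∀ a x y, ls a (x + y) = ls a x + ls a y
  ls_smul : ∀ (c : ℂ) a x, ls (c • a) x = c • ls a x
  ls_smul' : ∀ (c : ℂ) a x, ls a (c • x) = c • ls a x
  rs_one : ∀ x, rs x 1 = x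
  rs_mul : ∀ x b b', rs x (b * b') = rs (rs x b) b'
  rs_add : ∀ x b b', rs x (b + b') = rs x b + rs x b'
  rs_add' : ∀ x y b, rs (x + y) b = rs x b + rs y b
  rs_smul : ∀ (c : ℂ) x b, rs x (c • b) = c • rs x b
  rs_smul' : ∀ (c : ℂ) x b, rs (c • x) b = c • rs x b
  ls_rs : ∀ a x b, ls a (rs x b) = rs (ls a x) b
  linn_add_left : ∀ x y z, linn (x + y) z = linn x z + linn y z
  linn_add_right : ∀ x y z, linn x (y + z) = linn x y + linn x z
  rinn_add_left : ∀ x y z, rinn (x + y) z = rinn x z + rinn y z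
  rinn_add_right : ∀ x y z, rinn x (y + z) = rinn x y + rinn x z
  linn_smul_left : ∀ (c : ℂ) x y, linn (c • x) y = c • linn x y
  linn_smul_right : ∀ (c : ℂ) x y, linn x (c • y) = starRingEnd ℂ c • linn x y
  rinn_smul_left : ∀ (c : ℂ) x y, rinn (c • x) y = starRingEnd ℂ c • rinn x y
  rinn_smul_right : ∀ (c : ℂ) x y, rinn x (c • y) = c • rinn x y
  linn_star : ∀ x y, star (linn x y) = linn y x
  rinn_star : ∀ x y, star (rinn x y) = rinn y x
  linn_ls : ∀ a x y, linn (ls a x) y = a * linn x y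
  rinn_rs : ∀ x y b, rinn x (rs y b) = rinn x y * b
  linn_rs : ∀ x y b, linn (rs x b) y = linn x (rs y (star b))
  rinn_ls : ∀ a x y, rinn (ls a x) y = rinn x (ls (star a) y)
  linn_pos : ∀ x, ∃ a, linn x x = star a * a
  rinn_pos : ∀ x, ∃ b, rinn x x = star b * b
  rinn_def : ∀ x, rinn x x = 0 → x = 0

section BimodDefs
variable {A B X : Type u} [Ring A] [Algebra ℂ A] [StarRing A]
    [Ring B] [Algebra ℂ B] [StarRing B] [AddCommGroup X] [Module ℂ X]

/-- A Hilbert bimodule is of finite type if it admits a finite right basis and a finite left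
basis in the sense of Kajiwara–Watatani. -/
def Bimod.FiniteType (bm : Bimod A B X) : Prop :=
  (∃ (n : ℕ) (u : Fin n → X), ∀ x, ∑ i, bm.rs (u i) (bm.rinn (u i) x) = x) ∧
  (∃ (m : ℕ) (v : Fin m → X), ∀ x, ∑ j, bm.ls (bm.linn x (v j)) (v j) = x)

/-- An equivalence bimodule: both inner products are full and the associativity condition
`_A⟨x,y⟩ • z = x • ⟨y,z⟩_B` holds. -/
def Bimod.IsEquivalence (bm : Bimod A B X) : Prop :=
  (∀ x y z, bm.ls (bm.linn x y) z = bm.rs x (bm.rinn y z)) ∧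
  Submodule.span ℂ (Set.range fun p : X × X => bm.linn p.1 p.2) = ⊤ ∧
  Submodule.span ℂ (Set.range fun p : X × X => bm.rinn p.1 p.2) = ⊤

end BimodDefs

/-! ### Coactions on Hilbert bimodules, covariant systems, strong Morita equivalence -/

section BimodCoaction
variable {H0 : Type u} [Ring H0] [Algebra ℂ H0] [StarRing H0] [StarModule ℂ H0]
  [FiniteDimensional ℂ H0]
variable {A B X : Type u} [Ring A] [Algebra ℂ A] [StarRing A]
  [Ring B] [Algebra ℂ B] [StarRing B] [AddCommGroup X] [Module ℂ X]

/-- `(A, B, X, ρ, σ, λ, H0)` is a weak covariant system: `lam` is a weak coaction of `H0` on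
the Hilbert `A`–`B` bimodule `X` with respect to `(A, B, ρ, σ)`. -/
structure IsWeakCoactionBimod (ε0 : H0 →ₗ[ℂ] ℂ) (bm : Bimod A B X)
    (ρ : A →ₗ[ℂ] A ⊗[ℂ] H0) (σ : B →ₗ[ℂ] B ⊗[ℂ] H0)
    (lam : X →ₗ[ℂ] X ⊗[ℂ] H0) : Prop where
  ls_compat : ∀ a x, lam (bm.ls a x) = tact bm.ls (ρ a) (lam x)
  rs_compat : ∀ x b, lam (bm.rs x b) = tact bm.rs (lam x) (σ b)
  linn_compat : ∀ x y, ρ (bm.linn x y) = tinnL bm.linn (lam x) (lam y)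
  rinn_compat : ∀ x y, σ (bm.rinn x y) = tinnR bm.rinn (lam x) (lam y)
  counital : ∀ x, appRight ε0 (lam x) = x

/-- `(A, B, X, ρ, σ, λ, H0)` is a covariant system: `lam` is a coaction of `H0` on the
Hilbert `A`–`B` bimodule `X` with respect to `(A, B, ρ, σ)`. -/
structure IsCoactionBimod (Δ0 : H0 →ₗ[ℂ] H0 ⊗[ℂ] H0) (ε0 : H0 →ₗ[ℂ] ℂ) (bm : Bimod A B X)
    (ρ : A →ₗ[ℂ] A ⊗[ℂ] H0) (σ : B →ₗ[ℂ] B ⊗[ℂ] H0) (lam : X →ₗ[ℂ] X ⊗[ℂ] H0)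
    extends IsWeakCoactionBimod ε0 bm ρ σ lam : Prop where
  coassoc : ∀ x, TensorProduct.map lam LinearMap.id (lam x)
      = (TensorProduct.assoc ℂ X H0 H0).symm (TensorProduct.map LinearMap.id Δ0 (lam x))

/-- `(A, B, X, ρ, u, σ, v, λ, H0)` is a twisted covariant system: `lam` is a twisted coaction
of `H0` on the Hilbert `A`–`B` bimodule `X` with respect to `(A, B, ρ, u, σ, v)`. -/
structure IsTwistedCoactionBimod (Δ0 : H0 →ₗ[ℂ] H0 ⊗[ℂ] H0) (ε0 : H0 →ₗ[ℂ] ℂ)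
    (bm : Bimod A B X) (ρ : A →ₗ[ℂ] A ⊗[ℂ] H0) (u : (A ⊗[ℂ] H0) ⊗[ℂ] H0)
    (σ : B →ₗ[ℂ] B ⊗[ℂ] H0) (v : (B ⊗[ℂ] H0) ⊗[ℂ] H0) (lam : X →ₗ[ℂ] X ⊗[ℂ] H0)
    extends IsWeakCoactionBimod ε0 bm ρ σ lam : Prop where
  twisted : ∀ x, TensorProduct.map lam LinearMap.id (lam x)
      = tact (tact bm.rs)
          (tact (tact bm.ls) u
            ((TensorProduct.assoc ℂ X H0 H0).symm (TensorProduct.map LinearMap.id Δ0 (lam x))))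
          (tstarWith (tstarWith star) v)

/-- Two weak coactions `ρ` (on `A`) and `σ` (on `B`) of `H0` are strongly Morita equivalent
if there are an `A`–`B` equivalence bimodule `X` and a weak coaction of `H0` on `X` with
respect to `(A, B, ρ, σ)`. -/
def WeakSME (ε0 : H0 →ₗ[ℂ] ℂ) (ρ : A →ₗ[ℂ] A ⊗[ℂ] H0) (σ : B →ₗ[ℂ] B ⊗[ℂ] H0) : Prop :=
  ∃ (X : Type u) (_ : AddCommGroup X) (_ : Module ℂ X) (bm : Bimod A B X),
    bm.IsEquivalence ∧ ∃ lam : X →ₗ[ℂ] X ⊗[ℂ] H0, IsWeakCoactionBimod ε0 bm ρ σ lam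

/-- Two coactions `ρ` (on `A`) and `σ` (on `B`) of `H0` are strongly Morita equivalent if
there are an `A`–`B` equivalence bimodule `X` and a coaction of `H0` on `X` with respect to
`(A, B, ρ, σ)`. -/
def CoactSME (Δ0 : H0 →ₗ[ℂ] H0 ⊗[ℂ] H0) (ε0 : H0 →ₗ[ℂ] ℂ)
    (ρ : A →ₗ[ℂ] A ⊗[ℂ] H0) (σ : B →ₗ[ℂ] B ⊗[ℂ] H0) : Prop :=
  ∃ (X : Type u) (_ : AddCommGroup X) (_ : Module ℂ X) (bm : Bimod A B X),
    bm.IsEquivalence ∧ ∃ lam : X →ₗ[ℂ] X ⊗[ℂ] H0, IsCoactionBimod Δ0 ε0 bm ρ σ lam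

/-- Two twisted coactions `(ρ, u)` (on `A`) and `(σ, v)` (on `B`) of `H0` are strongly Morita
equivalent if there are an `A`–`B` equivalence bimodule `X` and a twisted coaction of `H0` on
`X` with respect to `(A, B, ρ, u, σ, v)`. -/
def TwistedSME (Δ0 : H0 →ₗ[ℂ] H0 ⊗[ℂ] H0) (ε0 : H0 →ₗ[ℂ] ℂ)
    (ρ : A →ₗ[ℂ] A ⊗[ℂ] H0) (u : (A ⊗[ℂ] H0) ⊗[ℂ] H0)
    (σ : B →ₗ[ℂ] B ⊗[ℂ] H0) (v : (B ⊗[ℂ] H0) ⊗[ℂ] H0) : Prop :=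
  ∃ (X : Type u) (_ : AddCommGroup X) (_ : Module ℂ X) (bm : Bimod A B X),
    bm.IsEquivalence ∧
      ∃ lam : X →ₗ[ℂ] X ⊗[ℂ] H0, IsTwistedCoactionBimod Δ0 ε0 bm ρ u σ v lam

end BimodCoaction
/-! ### Inner and strongly inner coactions -/

section Inner
variable {H0 : Type u} [Ring H0] [Algebra ℂ H0] [StarRing H0] [StarModule ℂ H0]
  [FiniteDimensional ℂ H0]
variable {A : Type u} [Ring A] [Algebra ℂ A] [StarRing A]

/-- The convolution product of two functionals `h, l` on `H0`:
`(hl)(φ) = (h ⊗ l)(Δ0 φ)`. -/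
def dualMul (Δ0 : H0 →ₗ[ℂ] H0 ⊗[ℂ] H0) (h l : Module.Dual ℂ H0) : Module.Dual ℂ H0 :=
  LinearMap.mul' ℂ ℂ ∘ₗ TensorProduct.map h l ∘ₗ Δ0

/-- A weak coaction `ρ` of `H0` on `A` is inner: there is a unitary `w ∈ A ⊗ H0` with
`ρ = Ad(w) ∘ ρ⁰` (where `ρ⁰` is the trivial coaction) and `(id ⊗ ε0)(w) = 1`. -/
def IsInnerCoaction (ε0 : H0 →ₗ[ℂ] ℂ) (ρ : A →ₗ[ℂ] A ⊗[ℂ] H0) : Prop :=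
  ∃ w : A ⊗[ℂ] H0, w * tstarWith star w = 1 ∧ tstarWith star w * w = 1 ∧
    (∀ a, ρ a = w * (a ⊗ₜ (1 : H0)) * tstarWith star w) ∧ appRight ε0 w = 1

/-- A coaction `ρ` of `H0` on `A` is strongly inner: it is implemented as `Ad(w) ∘ ρ⁰` by a
unitary `w ∈ A ⊗ H0` with `(id ⊗ ε0)(w) = 1` such that moreover `ŵ(hl) = ŵ(h)ŵ(l)` for all
`h, l ∈ H = (H0)^*`, where `ŵ(h) = (id ⊗ h)(w)`. -/
def IsStronglyInnerCoaction (Δ0 : H0 →ₗ[ℂ] H0 ⊗[ℂ] H0) (ε0 : H0 →ₗ[ℂ] ℂ)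
    (ρ : A →ₗ[ℂ] A ⊗[ℂ] H0) : Prop :=
  ∃ w : A ⊗[ℂ] H0, w * tstarWith star w = 1 ∧ tstarWith star w * w = 1 ∧
    (∀ a, ρ a = w * (a ⊗ₜ (1 : H0)) * tstarWith star w) ∧ appRight ε0 w = 1 ∧
    ∀ h l : Module.Dual ℂ H0,
      appRight (dualMul Δ0 h l) w = appRight h w * appRight l w

end Inner

/-! ### Bundled operations on tensor products -/

section TensorOperations

/-- The operation `tmix op cop` for sesquilinear `op` and `cop`, as a sesquilinear map. -/
def tmixSesq {P Q R C : Type*} [AddCommGroup P] [Module ℂ P] [AddCommGroup Q] [Module ℂ Q]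
    [AddCommGroup R] [Module ℂ R] [Ring C] [Algebra ℂ C] [FiniteDimensional ℂ C]
    {σ τ : ℂ →+* ℂ} (op : P →ₛₗ[σ] Q →ₛₗ[τ] R) (cop : C →ₛₗ[σ] C →ₛₗ[τ] C) :
    P ⊗[ℂ] C →ₛₗ[σ] Q ⊗[ℂ] C →ₛₗ[τ] R ⊗[ℂ] C :=
  LinearMap.mk₂'ₛₗ σ τ (tmix (fun p q => op p q) (fun c d => cop c d))
    (by intros; simp [tmix, TensorProduct.add_tmul, Finset.sum_add_distrib])
    (by intros; simp [tmix, ← TensorProduct.smul_tmul', Finset.smul_sum])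
    (by intros; simp [tmix, TensorProduct.add_tmul, Finset.sum_add_distrib])
    (by intros; simp [tmix, ← TensorProduct.smul_tmul', Finset.smul_sum])

@[simp]
theorem appRight_tmul {M C : Type*} [AddCommGroup M] [Module ℂ M] [AddCommGroup C] [Module ℂ C]
    (f : C →ₗ[ℂ] ℂ) (m : M) (c : C) : appRight f (m ⊗ₜ[ℂ] c) = f c • m := by
  simp [appRight]

theorem tmixSesq_tmul {P Q R C : Type*} [AddCommGroup P] [Module ℂ P] [AddCommGroup Q]
    [Module ℂ Q] [AddCommGroup R] [Module ℂ R] [Ring C] [Algebra ℂ C] [FiniteDimensional ℂ C]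
    {σ τ : ℂ →+* ℂ} (op : P →ₛₗ[σ] Q →ₛₗ[τ] R) (cop : C →ₛₗ[σ] C →ₛₗ[τ] C)
    (p : P) (q : Q) (c d : C) :
    tmixSesq op cop (p ⊗ₜ[ℂ] c) (q ⊗ₜ[ℂ] d) = op p q ⊗ₜ[ℂ] cop c d := by
  conv_rhs => rw [← (Module.finBasis ℂ C).sum_repr c, ← (Module.finBasis ℂ C).sum_repr d]
  simp only [map_sum, LinearMap.sum_apply, TensorProduct.tmul_sum, map_smulₛₗ,
    LinearMap.smul_apply, TensorProduct.tmul_smul]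
  simp only [Finset.smul_sum, smul_smul]
  rw [Finset.sum_comm]
  simp [tmixSesq, tmix, tcoord, ← TensorProduct.smul_tmul', smul_smul, mul_comm]

theorem tstarWith_star {M C : Type*} [AddCommGroup M] [Module ℂ M] [StarAddMonoid M]
    [StarModule ℂ M] [Ring C] [Algebra ℂ C] [StarRing C] [StarModule ℂ C]
    [FiniteDimensional ℂ C] (t : M ⊗[ℂ] C) : tstarWith star t = star t := by
  induction t using TensorProduct.induction_on with
  | zero => simp [tstarWith]
  | tmul m c =>
    conv_rhs => rw [TensorProduct.star_tmul, ← (Module.finBasis ℂ C).sum_repr c, star_sum,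
      TensorProduct.tmul_sum]
    simp [tstarWith, tcoord, TensorProduct.smul_tmul]
  | add s t hs ht =>
    rw [star_add, ← hs, ← ht]
    simp [tstarWith, TensorProduct.add_tmul, Finset.sum_add_distrib]

variable (C : Type*) [Ring C] [Algebra ℂ C] [StarRing C] [StarModule ℂ C]

/-- The sesquilinear map `(c, d) ↦ c * star d`. -/
def mulStar : C →ₗ[ℂ] C →ₗ⋆[ℂ] C :=
  LinearMap.mk₂'ₛₗ (RingHom.id ℂ) (starRingEnd ℂ) (fun c d => c * star d)
    (by simp [add_mul]) (by simp) (by simp [mul_add]) (by simp)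

/-- The sesquilinear map `(c, d) ↦ star c * d`. -/
def starMul : C →ₗ⋆[ℂ] C →ₗ[ℂ] C :=
  LinearMap.mk₂'ₛₗ (starRingEnd ℂ) (RingHom.id ℂ) (fun c d => star c * d)
    (by simp [add_mul]) (by simp) (by simp [mul_add]) (by simp)

end TensorOperations

/-! ### The bimodule `X ⊗ C` -/

namespace Bimod

variable {A B X : Type u} [Ring A] [Algebra ℂ A] [StarRing A]
  [Ring B] [Algebra ℂ B] [StarRing B] [AddCommGroup X] [Module ℂ X]
  {C : Type u} [Ring C] [Algebra ℂ C] [StarRing C] [StarModule ℂ C] [FiniteDimensional ℂ C]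
  (bm : Bimod A B X)

/-- The left action on a Hilbert bimodule as a bilinear map. -/
def lsBilin : A →ₗ[ℂ] X →ₗ[ℂ] X :=
  LinearMap.mk₂ ℂ bm.ls bm.ls_add bm.ls_smul bm.ls_add' bm.ls_smul'

/-- The right action on a Hilbert bimodule as a bilinear map. -/
def rsBilin : X →ₗ[ℂ] B →ₗ[ℂ] X :=
  LinearMap.mk₂ ℂ bm.rs bm.rs_add' bm.rs_smul' bm.rs_add bm.rs_smul

/-- The left inner product on a Hilbert bimodule as a sesquilinear map. -/
def linnSesq : X →ₗ[ℂ] X →ₗ⋆[ℂ] A :=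
  LinearMap.mk₂'ₛₗ (RingHom.id ℂ) (starRingEnd ℂ) bm.linn bm.linn_add_left bm.linn_smul_left
    bm.linn_add_right bm.linn_smul_right

/-- The right inner product on a Hilbert bimodule as a sesquilinear map. -/
def rinnSesq : X →ₗ⋆[ℂ] X →ₗ[ℂ] B :=
  LinearMap.mk₂'ₛₗ (starRingEnd ℂ) (RingHom.id ℂ) bm.rinn bm.rinn_add_left bm.rinn_smul_left
    bm.rinn_add_right bm.rinn_smul_right

variable (C) in
/-- The left action of `A ⊗ C` on `X ⊗ C`. -/
def tls : A ⊗[ℂ] C →ₗ[ℂ] X ⊗[ℂ] C →ₗ[ℂ] X ⊗[ℂ] C :=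
  tmixSesq bm.lsBilin (LinearMap.mul ℂ C)

variable (C) in
/-- The right action of `B ⊗ C` on `X ⊗ C`. -/
def trs : X ⊗[ℂ] C →ₗ[ℂ] B ⊗[ℂ] C →ₗ[ℂ] X ⊗[ℂ] C :=
  tmixSesq bm.rsBilin (LinearMap.mul ℂ C)

variable (C) in
/-- The `A ⊗ C`-valued inner product on `X ⊗ C`. -/
def tlinn : X ⊗[ℂ] C →ₗ[ℂ] X ⊗[ℂ] C →ₗ⋆[ℂ] A ⊗[ℂ] C :=
  tmixSesq bm.linnSesq (mulStar C)

variable (C) in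
/-- The `B ⊗ C`-valued inner product on `X ⊗ C`. -/
def trinn : X ⊗[ℂ] C →ₗ⋆[ℂ] X ⊗[ℂ] C →ₗ[ℂ] B ⊗[ℂ] C :=
  tmixSesq bm.rinnSesq (starMul C)

theorem tact_ls (s : A ⊗[ℂ] C) (t : X ⊗[ℂ] C) : tact bm.ls s t = bm.tls C s t := rfl

theorem tact_rs (s : X ⊗[ℂ] C) (t : B ⊗[ℂ] C) : tact bm.rs s t = bm.trs C s t := rfl

theorem tinnL_linn (s t : X ⊗[ℂ] C) : tinnL bm.linn s t = bm.tlinn C s t := rfl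

theorem tinnR_rinn (s t : X ⊗[ℂ] C) : tinnR bm.rinn s t = bm.trinn C s t := rfl

@[simp]
theorem tls_tmul (a : A) (x : X) (c d : C) :
    bm.tls C (a ⊗ₜ c) (x ⊗ₜ d) = bm.ls a x ⊗ₜ (c * d) := tmixSesq_tmul ..

@[simp]
theorem trs_tmul (x : X) (b : B) (c d : C) :
    bm.trs C (x ⊗ₜ c) (b ⊗ₜ d) = bm.rs x b ⊗ₜ (c * d) := tmixSesq_tmul ..

@[simp]
theorem tlinn_tmul (x y : X) (c d : C) :
    bm.tlinn C (x ⊗ₜ c) (y ⊗ₜ d) = bm.linn x y ⊗ₜ (c * star d) := tmixSesq_tmul ..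

@[simp]
theorem trinn_tmul (x y : X) (c d : C) :
    bm.trinn C (x ⊗ₜ c) (y ⊗ₜ d) = bm.rinn x y ⊗ₜ (star c * d) := tmixSesq_tmul ..

theorem star_tlinn [StarModule ℂ A] (s t : X ⊗[ℂ] C) :
    star (bm.tlinn C s t) = bm.tlinn C t s := by
  induction s using TensorProduct.induction_on with
  | zero => simp
  | add s s' hs hs' => simp [hs, hs']
  | tmul x c =>
    induction t using TensorProduct.induction_on with
    | zero => simp
    | add t t' ht ht' => simp only [map_add, LinearMap.add_apply, star_add, ht, ht']
    | tmul y d => simp [bm.linn_star]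

theorem tlinn_tls (a : A ⊗[ℂ] C) (s t : X ⊗[ℂ] C) :
    bm.tlinn C (bm.tls C a s) t = a * bm.tlinn C s t := by
  induction a using TensorProduct.induction_on with
  | zero => simp
  | add a a' ha ha' => simp [ha, ha', add_mul]
  | tmul a c =>
    induction s using TensorProduct.induction_on with
    | zero => simp
    | add s s' hs hs' => simp [hs, hs', mul_add]
    | tmul x d =>
      induction t using TensorProduct.induction_on with
      | zero => simp
      | add t t' ht ht' => simp only [map_add, ht, ht', mul_add]
      | tmul y e => simp [bm.linn_ls, mul_assoc]

theorem tls_tlinn (h : ∀ x y z, bm.ls (bm.linn x y) z = bm.rs x (bm.rinn y z))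
    (r s t : X ⊗[ℂ] C) :
    bm.tls C (bm.tlinn C r s) t = bm.trs C r (bm.trinn C s t) := by
  induction r using TensorProduct.induction_on with
  | zero => simp
  | add r r' hr hr' => simp [hr, hr']
  | tmul x c =>
    induction s using TensorProduct.induction_on with
    | zero => simp
    | add s s' hs hs' => simp only [map_add, LinearMap.add_apply, hs, hs']
    | tmul y d =>
      induction t using TensorProduct.induction_on with
      | zero => simp
      | add t t' ht ht' => simp only [map_add, ht, ht']
      | tmul z e => simp [h, mul_assoc]

theorem tlinn_mul_tlinn (h : ∀ x y z, bm.ls (bm.linn x y) z = bm.rs x (bm.rinn y z))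
    (q r s t : X ⊗[ℂ] C) :
    bm.tlinn C q r * bm.tlinn C s t = bm.tlinn C (bm.trs C q (bm.trinn C r s)) t := by
  rw [← bm.tls_tlinn h, tlinn_tls]

theorem appRight_tls_tmul_one (f : C →ₗ[ℂ] ℂ) (a : A ⊗[ℂ] C) (x : X) :
    appRight f (bm.tls C a (x ⊗ₜ 1)) = bm.ls (appRight f a) x := by
  change _ = bm.lsBilin (appRight f a) x
  induction a using TensorProduct.induction_on with
  | zero => simp
  | add a a' ha ha' => simp [ha, ha']
  | tmul a c => simp [lsBilin]

theorem appRight_tlinn_tmul_one (f : C →ₗ[ℂ] ℂ) (s : X ⊗[ℂ] C) (y : X) :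
    appRight f (bm.tlinn C s (y ⊗ₜ 1)) = bm.linn (appRight f s) y := by
  change _ = bm.linnSesq (appRight f s) y
  induction s using TensorProduct.induction_on with
  | zero => simp
  | add s s' hs hs' => simp [hs, hs']
  | tmul x c => simp [linnSesq]

/-- Fullness of the left inner product yields a finite family with `∑ ⟨xᵢ, yᵢ⟩ = 1`. -/
theorem exists_sum_linn_eq_one
    (h : Submodule.span ℂ (Set.range fun p : X × X => bm.linn p.1 p.2) = ⊤) :
    ∃ (n : ℕ) (x y : Fin n → X), ∑ i, bm.linn (x i) (y i) = 1 := by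
  obtain ⟨n, c, g, hg⟩ := Submodule.mem_span_set'.mp (h ▸ Submodule.mem_top (x := (1 : A)))
  choose p hp using fun i => (g i).2
  refine ⟨n, fun i => c i • (p i).1, fun i => (p i).2, ?_⟩
  rw [← hg]
  exact Finset.sum_congr rfl fun i _ => by rw [bm.linn_smul_left, ← hp i]

theorem eq_of_ls_eq (h : Submodule.span ℂ (Set.range fun p : X × X => bm.linn p.1 p.2) = ⊤)
    {a b : A} (hab : ∀ x, bm.ls a x = bm.ls b x) : a = b := by
  obtain ⟨n, x, y, hxy⟩ := bm.exists_sum_linn_eq_one h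
  rw [← mul_one a, ← mul_one b, ← hxy, Finset.mul_sum, Finset.mul_sum]
  exact Finset.sum_congr rfl fun i _ => by rw [← bm.linn_ls, ← bm.linn_ls, hab]

/-- A C*-algebra as a Hilbert bimodule over itself. -/
def self (A : Type u) [CStarAlgebra A] : Bimod A A A where
  ls a x := a * x
  rs x b := x * b
  linn x y := x * star y
  rinn x y := star x * y
  ls_one := one_mul
  ls_mul := mul_assoc
  ls_add := add_mul
  ls_add' := mul_add
  ls_smul := by simp
  ls_smul' := by simp
  rs_one := mul_one
  rs_mul := by simp [mul_assoc]
  rs_add := mul_add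
  rs_add' := add_mul
  rs_smul := by simp
  rs_smul' := by simp
  ls_rs := by simp [mul_assoc]
  linn_add_left := by simp [add_mul]
  linn_add_right := by simp [mul_add]
  rinn_add_left := by simp [add_mul]
  rinn_add_right := by simp [mul_add]
  linn_smul_left := by simp
  linn_smul_right := by simp
  rinn_smul_left := by simp
  rinn_smul_right := by simp
  linn_star := by simp
  rinn_star := by simp
  linn_ls := by simp [mul_assoc]
  rinn_rs := by simp [mul_assoc]
  linn_rs := by simp [mul_assoc]
  rinn_ls := by simp [mul_assoc]
  linn_pos x := ⟨star x, by simp⟩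
  rinn_pos x := ⟨x, rfl⟩
  rinn_def x := CStarRing.star_mul_self_eq_zero_iff x |>.mp

theorem self_isEquivalence (A : Type u) [CStarAlgebra A] : (self A).IsEquivalence := by
  refine ⟨fun x y z => mul_assoc .., ?_, ?_⟩
  · exact Submodule.eq_top_iff'.mpr fun a => Submodule.subset_span ⟨(a, 1), by simp [self]⟩
  · exact Submodule.eq_top_iff'.mpr fun a => Submodule.subset_span ⟨(1, a), by simp [self]⟩

section Self

variable {A : Type u} [CStarAlgebra A]

theorem self_tls (s t : A ⊗[ℂ] C) : (self A).tls C s t = s * t := by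
  induction s using TensorProduct.induction_on with
  | zero => simp
  | add s s' hs hs' => simp [hs, hs', add_mul]
  | tmul a c =>
    induction t using TensorProduct.induction_on with
    | zero => simp
    | add t t' ht ht' => simp only [map_add, ht, ht', mul_add]
    | tmul b d => simp [self]

theorem self_trs (s t : A ⊗[ℂ] C) : (self A).trs C s t = s * t := by
  induction s using TensorProduct.induction_on with
  | zero => simp
  | add s s' hs hs' => simp [hs, hs', add_mul]
  | tmul a c =>
    induction t using TensorProduct.induction_on with
    | zero => simp
    | add t t' ht ht' => simp only [map_add, ht, ht', mul_add]
    | tmul b d => simp [self]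

theorem self_tlinn (s t : A ⊗[ℂ] C) : (self A).tlinn C s t = s * star t := by
  induction s using TensorProduct.induction_on with
  | zero => simp
  | add s s' hs hs' => simp [hs, hs', add_mul]
  | tmul a c =>
    induction t using TensorProduct.induction_on with
    | zero => simp
    | add t t' ht ht' => simp only [map_add, ht, ht', mul_add, star_add]
    | tmul b d => simp [self]

theorem self_trinn (s t : A ⊗[ℂ] C) : (self A).trinn C s t = star s * t := by
  induction s using TensorProduct.induction_on with
  | zero => simp
  | add s s' hs hs' => simp [hs, hs', add_mul]
  | tmul a c =>
    induction t using TensorProduct.induction_on with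
    | zero => simp
    | add t t' ht ht' => simp only [map_add, ht, ht', mul_add]
    | tmul b d => simp [self]

end Self

end Bimod

/-! ### Slicing tensors -/

section Slicing

variable {M N C : Type*} [AddCommGroup M] [Module ℂ M] [AddCommGroup N] [Module ℂ N]
  [AddCommGroup C] [Module ℂ C]

theorem eq_of_appRight_eq [FiniteDimensional ℂ C] {s t : M ⊗[ℂ] C}
    (h : ∀ f : Module.Dual ℂ C, appRight f s = appRight f t) : s = t := by
  have key : ∀ r : M ⊗[ℂ] C, ∑ i, tcoord i r ⊗ₜ[ℂ] Module.finBasis ℂ C i = r := by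
    intro r
    induction r using TensorProduct.induction_on with
    | zero => simp
    | add r r' hr hr' =>
      simp only [map_add, TensorProduct.add_tmul, Finset.sum_add_distrib, hr, hr']
    | tmul m c =>
      conv_rhs => rw [← (Module.finBasis ℂ C).sum_repr c, TensorProduct.tmul_sum]
      simp [tcoord, TensorProduct.smul_tmul]
  rw [← key s, ← key t]
  exact Finset.sum_congr rfl fun i _ => by rw [tcoord, h]

theorem appRight_map_id (f : Module.Dual ℂ C) (g : M →ₗ[ℂ] N) (t : M ⊗[ℂ] C) :
    appRight f (TensorProduct.map g LinearMap.id t) = g (appRight f t) := by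
  induction t using TensorProduct.induction_on with
  | zero => simp
  | add s t hs ht => simp [hs, ht]
  | tmul m c => simp

end Slicing

section DualMul

variable {H0 : Type u} [Ring H0] [Algebra ℂ H0] [StarRing H0] [StarModule ℂ H0]
  [FiniteDimensional ℂ H0] {M : Type*} [AddCommGroup M] [Module ℂ M]

theorem appRight_appRight_assoc_symm (h l : Module.Dual ℂ H0) (m : M) (u : H0 ⊗[ℂ] H0) :
    appRight h (appRight l ((TensorProduct.assoc ℂ M H0 H0).symm (m ⊗ₜ u)))
      = LinearMap.mul' ℂ ℂ (TensorProduct.map h l u) • m := by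
  induction u using TensorProduct.induction_on with
  | zero => simp
  | add s t hs ht => simp [hs, ht, TensorProduct.tmul_add, add_smul]
  | tmul c d => simp [smul_smul, mul_comm]

theorem appRight_appRight_comul (Δ0 : H0 →ₗ[ℂ] H0 ⊗[ℂ] H0) (h l : Module.Dual ℂ H0)
    (t : M ⊗[ℂ] H0) :
    appRight h (appRight l ((TensorProduct.assoc ℂ M H0 H0).symm
      (TensorProduct.map LinearMap.id Δ0 t))) = appRight (dualMul Δ0 h l) t := by
  induction t using TensorProduct.induction_on with
  | zero => simp
  | add s t hs ht => simp [hs, ht]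
  | tmul m c => simp [appRight_appRight_assoc_symm, dualMul]

end DualMul

/-! ### Strong Morita equivalence with the trivial coaction -/

section Main

variable {H0 : Type u} [CStarAlgebra H0] [FiniteDimensional ℂ H0]
  {A : Type u} [CStarAlgebra A]

@[simp]
theorem trivialCoaction_apply (a : A) : trivialCoaction H0 A a = a ⊗ₜ 1 := rfl

/-- The linear map `x ↦ w (x ⊗ 1)`. -/
def mulTrivial (w : A ⊗[ℂ] H0) : A →ₗ[ℂ] A ⊗[ℂ] H0 :=
  LinearMap.mulLeft ℂ w ∘ₗ trivialCoaction H0 A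

@[simp]
theorem mulTrivial_apply (w : A ⊗[ℂ] H0) (x : A) : mulTrivial w x = w * (x ⊗ₜ 1) := rfl

theorem appRight_mul_tmul_one (f : Module.Dual ℂ H0) (w : A ⊗[ℂ] H0) (x : A) :
    appRight f (w * (x ⊗ₜ 1)) = appRight f w * x := by
  rw [← Bimod.self_tls, Bimod.appRight_tls_tmul_one]
  rfl

theorem isWeakCoactionBimod_mulTrivial {ε0 : H0 →ₗ[ℂ] ℂ} {ρ : A →ₗ[ℂ] A ⊗[ℂ] H0}
    {w : A ⊗[ℂ] H0} (hw : star w * w = 1)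
    (hρ : ∀ a, ρ a = w * (a ⊗ₜ (1 : H0)) * star w) (hε : appRight ε0 w = 1) :
    IsWeakCoactionBimod ε0 (Bimod.self A) ρ (trivialCoaction H0 A) (mulTrivial w) where
  ls_compat a x := by
    rw [Bimod.tact_ls, Bimod.self_tls, hρ]
    simp only [mulTrivial_apply, mul_assoc]
    rw [← mul_assoc (star w), hw, one_mul, Algebra.TensorProduct.tmul_mul_tmul, one_mul]
    rfl
  rs_compat x b := by
    rw [Bimod.tact_rs, Bimod.self_trs]
    simp [Bimod.self, mul_assoc]
  linn_compat x y := by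
    rw [Bimod.tinnL_linn, Bimod.self_tlinn, hρ]
    simp only [mulTrivial_apply, star_mul, TensorProduct.star_tmul, star_one, mul_assoc]
    rw [← mul_assoc (x ⊗ₜ[ℂ] (1 : H0)), Algebra.TensorProduct.tmul_mul_tmul, one_mul]
    rfl
  rinn_compat x y := by
    rw [Bimod.tinnR_rinn, Bimod.self_trinn]
    simp only [mulTrivial_apply, star_mul, TensorProduct.star_tmul, star_one, mul_assoc]
    rw [← mul_assoc (star w), hw, one_mul, Algebra.TensorProduct.tmul_mul_tmul, one_mul]
    rfl
  counital x := by
    rw [mulTrivial_apply, appRight_mul_tmul_one, hε, one_mul]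

theorem mulTrivial_coassoc {Δ0 : H0 →ₗ[ℂ] H0 ⊗[ℂ] H0} {w : A ⊗[ℂ] H0}
    (hw : ∀ h l : Module.Dual ℂ H0,
      appRight (dualMul Δ0 h l) w = appRight h w * appRight l w) (x : A) :
    TensorProduct.map (mulTrivial w) LinearMap.id (mulTrivial w x)
      = (TensorProduct.assoc ℂ A H0 H0).symm
          (TensorProduct.map LinearMap.id Δ0 (mulTrivial w x)) := by
  refine eq_of_appRight_eq fun l => eq_of_appRight_eq fun h => ?_
  rw [appRight_map_id, appRight_appRight_comul]
  simp only [mulTrivial_apply, appRight_mul_tmul_one, hw, mul_assoc]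

/-- A weak coaction on an equivalence bimodule with respect to `ρ` and the trivial coaction is
given by `x ↦ w (x ⊗ 1)` for a unitary `w` implementing `ρ`. -/
theorem exists_unitary_of_isWeakCoactionBimod {ε0 : H0 →ₗ[ℂ] ℂ}
    {ρ : A →ₗ[ℂ] A ⊗[ℂ] H0} (hρ : IsWeakCoaction ε0 ρ)
    {X : Type u} [AddCommGroup X] [Module ℂ X] {bm : Bimod A A X} (hbm : bm.IsEquivalence)
    {lam : X →ₗ[ℂ] X ⊗[ℂ] H0}
    (hlam : IsWeakCoactionBimod ε0 bm ρ (trivialCoaction H0 A) lam) :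
    ∃ w : A ⊗[ℂ] H0, w * star w = 1 ∧ star w * w = 1 ∧
      (∀ a, ρ a = w * (a ⊗ₜ (1 : H0)) * star w) ∧ appRight ε0 w = 1 ∧
      ∀ x, bm.tls H0 w (x ⊗ₜ 1) = lam x := by
  obtain ⟨hassoc, hfull, -⟩ := hbm
  obtain ⟨n, x, y, hxy⟩ := bm.exists_sum_linn_eq_one hfull
  have hsum (z : X) : ∑ i, bm.ls (bm.linn (x i) (y i)) z = z := by
    have := congrArg (fun a => bm.lsBilin a z) hxy
    simp only [map_sum, LinearMap.sum_apply] at this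
    exact this.trans (bm.ls_one z)
  have hyx : ∑ i, bm.linn (y i) (x i) = 1 := by
    rw [← star_one A, ← hxy, star_sum]
    simp only [bm.linn_star]
  have hls := hlam.ls_compat
  have hrs := hlam.rs_compat
  have hlinn := hlam.linn_compat
  have hrinn := hlam.rinn_compat
  simp only [Bimod.tact_ls, Bimod.tact_rs, Bimod.tinnL_linn, Bimod.tinnR_rinn,
    trivialCoaction_apply] at hls hrs hlinn hrinn
  obtain ⟨w, hw⟩ : ∃ w : A ⊗[ℂ] H0, w = ∑ i, bm.tlinn H0 (lam (x i)) (y i ⊗ₜ 1) := ⟨_, rfl⟩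
  have hstar : star w = ∑ i, bm.tlinn H0 (y i ⊗ₜ 1) (lam (x i)) := by
    simp only [hw, star_sum, Bimod.star_tlinn]
  have hwlam (z : X) : bm.tls H0 w (z ⊗ₜ 1) = lam z := by
    simp only [hw, map_sum, LinearMap.sum_apply, bm.tls_tlinn hassoc, Bimod.trinn_tmul,
      star_one, one_mul, ← hrs, ← hassoc]
    rw [← map_sum, hsum]
  have hone : w * star w = 1 := by
    rw [hstar, Finset.mul_sum]
    simp only [← bm.tlinn_tls, hwlam, ← hlinn]
    rw [← map_sum, hyx, hρ.map_one]
  have hone' : star w * w = 1 := by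
    rw [hstar, hw, Finset.sum_mul_sum]
    simp only [bm.tlinn_mul_tlinn hassoc, ← hrinn, Bimod.trs_tmul, one_mul,
      Bimod.tlinn_tmul, star_one, ← hassoc, bm.linn_ls]
    simp only [← TensorProduct.sum_tmul]
    rw [← Finset.sum_mul_sum, hxy, hyx, one_mul, Algebra.TensorProduct.one_def]
  have hcomm (a : A) : ρ a * w = w * (a ⊗ₜ 1) := by
    have h1 : (a ⊗ₜ[ℂ] (1 : H0)) = ∑ i, bm.tlinn H0 (bm.ls a (x i) ⊗ₜ 1) (y i ⊗ₜ 1) := by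
      simp only [Bimod.tlinn_tmul, star_one, one_mul, bm.linn_ls]
      rw [← TensorProduct.sum_tmul, ← Finset.mul_sum, hxy, mul_one]
    rw [h1, Finset.mul_sum]
    simp only [← bm.tlinn_tls, hwlam, hls]
    simp only [bm.tlinn_tls]
    rw [← Finset.mul_sum, ← hw]
  refine ⟨w, hone, hone', fun a => ?_, ?_, hwlam⟩
  · rw [← hcomm, mul_assoc, hone, mul_one]
  · simp only [hw, map_sum, Bimod.appRight_tlinn_tmul_one, hlam.counital, hxy]

end Main

/-- (i) A weak coaction `ρ` of `H0` on a unital C*-algebra `A` is inner if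
and only if `ρ` is strongly Morita equivalent to the trivial coaction `ρ^A_{H0} : a ↦ a ⊗ 1`.
(ii) A coaction `ρ` of `H0` on `A` is strongly inner if and only if `ρ` is strongly Morita
equivalent to the trivial coaction. -/
theorem inner_iff_strongMorita_trivial
    {H0 : Type u} [CStarAlgebra H0] [StarModule ℂ H0] [FiniteDimensional ℂ H0]
    {A : Type u} [CStarAlgebra A] [StarModule ℂ A] (hd : HopfAlgData H0) :
    (∀ ρ : A →ₗ[ℂ] A ⊗[ℂ] H0, IsWeakCoaction hd.counit.toLinearMap ρ →
      (IsInnerCoaction hd.counit.toLinearMap ρ ↔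
        WeakSME hd.counit.toLinearMap ρ (trivialCoaction H0 A))) ∧
    (∀ ρ : A →ₗ[ℂ] A ⊗[ℂ] H0,
      IsCoaction hd.comul.toLinearMap hd.counit.toLinearMap ρ →
      (IsStronglyInnerCoaction hd.comul.toLinearMap hd.counit.toLinearMap ρ ↔
        CoactSME hd.comul.toLinearMap hd.counit.toLinearMap ρ (trivialCoaction H0 A))) := by
  have hstar (w : A ⊗[ℂ] H0) : tstarWith star w = star w := tstarWith_star w
  simp only [IsInnerCoaction, IsStronglyInnerCoaction, hstar]
  refine ⟨fun ρ hρ => ⟨?_, ?_⟩, fun ρ hρ => ⟨?_, ?_⟩⟩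
  · rintro ⟨w, -, hw, hwρ, hwε⟩
    exact ⟨A, inferInstance, inferInstance, Bimod.self A, Bimod.self_isEquivalence A,
      mulTrivial w, isWeakCoactionBimod_mulTrivial hw hwρ hwε⟩
  · rintro ⟨X, _, _, bm, hbm, lam, hlam⟩
    obtain ⟨w, h1, h2, h3, h4, -⟩ :=
      exists_unitary_of_isWeakCoactionBimod hρ hbm hlam
    exact ⟨w, h1, h2, h3, h4⟩
  · rintro ⟨w, -, hw, hwρ, hwε, hwm⟩
    exact ⟨A, inferInstance, inferInstance, Bimod.self A, Bimod.self_isEquivalence A,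
      mulTrivial w, isWeakCoactionBimod_mulTrivial hw hwρ hwε, mulTrivial_coassoc hwm⟩
  · rintro ⟨X, _, _, bm, hbm, lam, hlam⟩
    obtain ⟨w, h1, h2, h3, h4, hwlam⟩ :=
      exists_unitary_of_isWeakCoactionBimod hρ.toIsWeakCoaction hbm
        hlam.toIsWeakCoactionBimod
    refine ⟨w, h1, h2, h3, h4, fun h l => bm.eq_of_ls_eq hbm.2.1 fun x => ?_⟩
    rw [bm.ls_mul]
    simp only [← bm.appRight_tls_tmul_one, hwlam]
    rw [← appRight_appRight_comul, ← hlam.coassoc, appRight_map_id]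

end SMEPaper
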